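/- arXiv:2211.09020 — 2 statements merged into one kernel-verified Lean document; each statement's English description precedes it below -/
import Mathlib

section
/- Let τ be a CC trace with τ ⊨ CC and let τ' be obtained from τ by a begin step, adding a fresh transaction t ∉ T together with a single new po edge (t₀, t) for some t₀ ∈ T, and leaving rf unchanged. Then τ' ⊨ CC. -/
open Relation

/-- A CC trace: transactions `T`, per-variable write/read sets `W`, `R`,
program order `po` and per-variable reads-from `rf`. -/
structure CCTrace (α V : Type*) where
  T : Set α
  W : V → Set α
  R : V → Set α
  po : α → α → Prop
  rf : V → α → α → Prop
  W_sub : ∀ x, W x ⊆ T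
  R_sub : ∀ x, R x ⊆ T
  po_mem : ∀ a b, po a b → a ∈ T ∧ b ∈ T
  rf_mem : ∀ x a b, rf x a b → a ∈ W x ∧ b ∈ R x

namespace CCTrace

variable {α V : Type*}

/-- The union of the reads-from relations over all variables. -/
def rfU (τ : CCTrace α V) (a b : α) : Prop := ∃ x, τ.rf x a b

/-- po ∪ rf. -/
def porf (τ : CCTrace α V) (a b : α) : Prop := τ.po a b ∨ τ.rfU a b

/-- Two transactions are concurrent if they are incomparable in `(po ∪ rf)⁺`. -/
def Concurrent (τ : CCTrace α V) (a b : α) : Prop :=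
  ¬ TransGen τ.porf a b ∧ ¬ TransGen τ.porf b a

/-- A CC trace is fulfilled if whenever `(po ∪ rf)⁺ t t''` and `rf^x t' t''`
for writers t, t' of x, then t and t' are concurrent or `(po ∪ rf)* t t'`. -/
def Fulfilled (τ : CCTrace α V) : Prop :=
  ∀ x t t' t'', t ∈ τ.W x → t' ∈ τ.W x →
    TransGen τ.porf t t'' → τ.rf x t' t'' →
    τ.Concurrent t t' ∨ ReflTransGen τ.porf t t'

/-- τ ⊨ CC (partially good). -/
def SatCC (τ : CCTrace α V) : Prop :=
  (∀ x t₁ t₂ t₃, t₁ ∈ τ.W x → t₃ ∈ τ.W x → t₂ ∈ τ.R x →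
      τ.rf x t₁ t₂ → TransGen τ.porf t₃ t₂ →
      τ.Concurrent t₃ t₁ ∨ ReflTransGen τ.porf t₃ t₁) ∧
  (∀ a, ¬ TransGen τ.porf a a)

/-- cc-cond1 for a candidate source `t'` of a read of `x` in `t`. -/
def ccCond1 (τ : CCTrace α V) (x : V) (t t' : α) : Prop :=
  ∃ t₃, t₃ ∈ τ.W x ∧ TransGen τ.porf t' t₃ ∧ TransGen τ.porf t₃ t

/-- cc-cond2. -/
def ccCond2 (τ : CCTrace α V) (x : V) (t t' : α) : Prop :=
  ∃ y t₃ t₄, y ≠ x ∧ τ.rf y t₄ t ∧ TransGen τ.porf t₄ t₃ ∧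
    ReflTransGen τ.porf t₃ t' ∧ t₃ ∈ τ.W y

/-- The CC readable set rbl(τ, t, x). -/
def rbl (τ : CCTrace α V) (t : α) (x : V) : Set α :=
  {t' | t' ∈ τ.W x ∧ ¬ τ.ccCond1 x t t' ∧ ¬ τ.ccCond2 x t t'}

/-- `t` has no outgoing po or rf edges. -/
def NoOut (τ : CCTrace α V) (t : α) : Prop :=
  (∀ s, ¬ τ.po t s) ∧ (∀ y s, ¬ τ.rf y t s)

/-- The begin step: add a fresh transaction `t ∉ T` with one new po edge `(t₀, t)`. -/
def beginStep (τ : CCTrace α V) (t t₀ : α) (hnew : t ∉ τ.T) (h₀ : t₀ ∈ τ.T) :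
    CCTrace α V where
  T := τ.T ∪ {t}
  W := τ.W
  R := τ.R
  po := fun a b => τ.po a b ∨ (a = t₀ ∧ b = t)
  rf := τ.rf
  W_sub := fun x a ha => Set.mem_union_left _ (τ.W_sub x ha)
  R_sub := fun x a ha => Set.mem_union_left _ (τ.R_sub x ha)
  po_mem := by
    rintro a b (h | ⟨ha, hb⟩)
    · exact ⟨Set.mem_union_left _ (τ.po_mem a b h).1, Set.mem_union_left _ (τ.po_mem a b h).2⟩
    · exact ⟨ha ▸ Set.mem_union_left _ h₀, Set.mem_union_right _ hb⟩
  rf_mem := τ.rf_mem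

/-- The CC read step: `t ∈ R x` reads `x` from `t' ∈ rbl(τ, t, x)`:
add the rf^x edge (t', t). -/
def readStep (τ : CCTrace α V) (x : V) (t t' : α)
    (ht : t ∈ τ.R x) (ht' : t' ∈ τ.rbl t x) : CCTrace α V where
  T := τ.T
  W := τ.W
  R := τ.R
  po := τ.po
  rf := fun y a b => τ.rf y a b ∨ (y = x ∧ a = t' ∧ b = t)
  W_sub := τ.W_sub
  R_sub := τ.R_sub
  po_mem := τ.po_mem
  rf_mem := by
    rintro y a b (h | ⟨rfl, rfl, rfl⟩)
    · exact τ.rf_mem y a b h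
    · exact ⟨ht'.1, ht⟩

end CCTrace

namespace CCTrace

variable {α V : Type*} (τ : CCTrace α V)

theorem porf_mem {a b : α} (h : τ.porf a b) : a ∈ τ.T ∧ b ∈ τ.T := by
  rcases h with h | ⟨x, h⟩
  · exact τ.po_mem a b h
  · exact ⟨τ.W_sub x (τ.rf_mem x a b h).1, τ.R_sub x (τ.rf_mem x a b h).2⟩

variable {t t₀ : α} (hnew : t ∉ τ.T) (h₀ : t₀ ∈ τ.T)

theorem porf_beginStep_iff {a b : α} :
    (τ.beginStep t t₀ hnew h₀).porf a b ↔ τ.porf a b ∨ (a = t₀ ∧ b = t) :=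
  or_right_comm

theorem porf_beginStep_source_mem {a b : α} (h : (τ.beginStep t t₀ hnew h₀).porf a b) :
    a ∈ τ.T := by
  rcases (τ.porf_beginStep_iff hnew h₀).1 h with h | ⟨rfl, -⟩
  · exact (τ.porf_mem h).1
  · exact h₀

theorem transGen_porf_beginStep_iff {a b : α} (hb : b ∈ τ.T) :
    TransGen (τ.beginStep t t₀ hnew h₀).porf a b ↔ TransGen τ.porf a b := by
  have old {c d : α} (hd : d ∈ τ.T) (h : (τ.beginStep t t₀ hnew h₀).porf c d) : τ.porf c d :=
    ((τ.porf_beginStep_iff hnew h₀).1 h).resolve_right fun h' => hnew (h'.2 ▸ hd)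
  refine ⟨fun h => ?_, TransGen.mono (fun _ _ h => (τ.porf_beginStep_iff hnew h₀).2 (.inl h)) a b⟩
  induction h with
  | single h => exact .single (old hb h)
  | tail _ h ih => exact (ih (τ.porf_beginStep_source_mem hnew h₀ h)).tail (old hb h)

end CCTrace

open Relation CCTrace in
/-- the CC begin step preserves τ ⊨ CC. -/
theorem cc_satCC_beginStep {α V : Type*} (τ : CCTrace α V) (t t₀ : α)
    (hnew : t ∉ τ.T) (h₀ : t₀ ∈ τ.T) (hsat : τ.SatCC) :
    (τ.beginStep t t₀ hnew h₀).SatCC := by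
  refine ⟨fun x t₁ t₂ t₃ h₁ h₃ h₂ hrf h₃₂ => ?_, fun a ha => ?_⟩
  · have key {a b : α} (hb : b ∈ τ.T) := τ.transGen_porf_beginStep_iff hnew h₀ (a := a) hb
    have := hsat.1 x t₁ t₂ t₃ h₁ h₃ h₂ hrf ((key (τ.R_sub x h₂)).1 h₃₂)
    simpa only [Concurrent, reflTransGen_iff_eq_or_transGen, key (τ.W_sub x h₁),
      key (τ.W_sub x h₃)] using this
  · obtain ⟨b, hab, -⟩ := TransGen.head'_iff.1 ha
    have haT := τ.porf_beginStep_source_mem hnew h₀ hab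
    exact hsat.2 a ((τ.transGen_porf_beginStep_iff hnew h₀ haT).1 ha)
end

section
/- With the event relations B₁, B₂ and B₃ built from a trace as in the construction below, if in addition (po ∪ rf ∪ co)⁺ is irreflexive, then the relation (B₁ ∪ B₂ ∪ B₃)⁺ on the event set E is irreflexive. -/
open Relation

/-- A CCv trace: transactions `T`, per-variable write/read sets `W`, `R`,
program order `po`, per-variable reads-from `rf` and coherence `co`. -/
structure CCvTrace (α V : Type*) where
  T : Set α
  W : V → Set α
  R : V → Set α
  po : α → α → Prop
  rf : V → α → α → Prop
  co : V → α → α → Prop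
  W_sub : ∀ x, W x ⊆ T
  R_sub : ∀ x, R x ⊆ T
  po_mem : ∀ a b, po a b → a ∈ T ∧ b ∈ T
  rf_mem : ∀ x a b, rf x a b → a ∈ W x ∧ b ∈ R x
  co_mem : ∀ x a b, co x a b → a ∈ W x ∧ b ∈ W x

namespace CCvTrace

variable {α V : Type*}

/-- The union of the reads-from relations over all variables. -/
def rfU (τ : CCvTrace α V) (a b : α) : Prop := ∃ x, τ.rf x a b

/-- The union of the coherence relations over all variables. -/
def coU (τ : CCvTrace α V) (a b : α) : Prop := ∃ x, τ.co x a b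

/-- po ∪ rf. -/
def porf (τ : CCvTrace α V) (a b : α) : Prop := τ.po a b ∨ τ.rfU a b

/-- po ∪ rf ∪ co. -/
def porfco (τ : CCvTrace α V) (a b : α) : Prop := τ.porf a b ∨ τ.coU a b

/-- po ∪ rf ∪ co^x. -/
def porfcox (τ : CCvTrace α V) (x : V) (a b : α) : Prop := τ.porf a b ∨ τ.co x a b

/-- A trace is fulfilled if whenever `(po ∪ rf ∪ co^x)⁺ t t''` and `rf^x t' t''`
for distinct writers `t ≠ t'` of `x`, then `(po ∪ rf ∪ co^x)⁺ t t'`. -/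
def Fulfilled (τ : CCvTrace α V) : Prop :=
  ∀ x t t' t'', t ∈ τ.W x → t' ∈ τ.W x → t ≠ t' →
    TransGen (τ.porfcox x) t t'' → τ.rf x t' t'' →
    TransGen (τ.porfcox x) t t'

/-- τ ⊨ CCv (partially good). -/
def SatCCv (τ : CCvTrace α V) : Prop :=
  (∀ x t₁ t₂ t₃, t₁ ∈ τ.W x → t₃ ∈ τ.W x → t₃ ≠ t₁ → t₂ ∈ τ.R x →
      τ.rf x t₁ t₂ → TransGen τ.porf t₃ t₂ → τ.co x t₃ t₁) ∧
  (∀ a, ¬ TransGen τ.porfco a a)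

/-- The trace is total: each `co^x` is a strict total order on `W x`. -/
def IsTotal (τ : CCvTrace α V) : Prop :=
  ∀ x, (∀ a, ¬ τ.co x a a) ∧
    (∀ a b c, τ.co x a b → τ.co x b c → τ.co x a c) ∧
    (∀ a b, a ∈ τ.W x → b ∈ τ.W x → a ≠ b → τ.co x a b ∨ τ.co x b a)

/-- τ ⊑ τ' : same transactions, write/read sets, po and rf; co only grows. -/
def Weaker (τ τ' : CCvTrace α V) : Prop :=
  τ.T = τ'.T ∧ τ.W = τ'.W ∧ τ.R = τ'.R ∧ τ.po = τ'.po ∧ τ.rf = τ'.rf ∧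
  ∀ x a b, τ.co x a b → τ'.co x a b

/-- τ is CCv-consistent: it extends to a total trace satisfying CCv. -/
def CCvConsistent (τ : CCvTrace α V) : Prop :=
  ∃ τ' : CCvTrace α V, τ.Weaker τ' ∧ τ'.IsTotal ∧ τ'.SatCCv

/-- τ ⊙ (t₁, t₂): add the pair (t₁, t₂) to co^x. -/
def addCo (τ : CCvTrace α V) (x : V) (t₁ t₂ : α) (h₁ : t₁ ∈ τ.W x) (h₂ : t₂ ∈ τ.W x) :
    CCvTrace α V where
  T := τ.T
  W := τ.W
  R := τ.R
  po := τ.po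
  rf := τ.rf
  co := fun y a b => τ.co y a b ∨ (y = x ∧ a = t₁ ∧ b = t₂)
  W_sub := τ.W_sub
  R_sub := τ.R_sub
  po_mem := τ.po_mem
  rf_mem := τ.rf_mem
  co_mem := by
    rintro y a b (h | ⟨rfl, rfl, rfl⟩)
    · exact τ.co_mem y a b h
    · exact ⟨h₁, h₂⟩

end CCvTrace

open Relation

/-- Events: issue and delivery events, tagged with a process and a transaction. -/
inductive Ev (P α : Type*) where
  | isu : P → α → Ev P α
  | del : P → α → Ev P α

namespace Ev

variable {P α : Type*}

/-- The process of an event. -/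
def procOf : Ev P α → P
  | .isu p _ => p
  | .del p _ => p

/-- The underlying transaction of an event. -/
def transOf : Ev P α → α
  | .isu _ t => t
  | .del _ t => t

end Ev

namespace CCvTrace

variable {α V P : Type*}

/-- The happens-before relation hb = (po ∪ rf)⁺. -/
def hb (τ : CCvTrace α V) : α → α → Prop := TransGen τ.porf

/-- The set W of all transactions writing some variable. -/
def Wall (τ : CCvTrace α V) : Set α := {a | ∃ x, a ∈ τ.W x}

/-- A_p : the transactions of process p. -/
def Aset (τ : CCvTrace α V) (proc : α → P) (p : P) : Set α :=
  {a | a ∈ τ.T ∧ proc a = p}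

/-- A'_p = A_p ∪ W. -/
def Aset' (τ : CCvTrace α V) (proc : α → P) (p : P) : Set α :=
  τ.Aset proc p ∪ τ.Wall

/-- The order <_p on transactions used to build the event relations. -/
def ltp (τ : CCvTrace α V) (proc : α → P) (p : P) (a b : α) : Prop :=
  (a ∈ τ.Aset' proc p ∧ b ∈ τ.Aset' proc p ∧ τ.hb a b) ∨
  (a ∈ τ.Aset proc p ∧ b ∈ τ.Aset' proc p ∧ b ∉ τ.Aset proc p ∧ ¬ τ.hb b a)

/-- The event set E: issue events isu(p, t) for t ∈ A_p and delivery events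
del(p, t) for t ∈ A'_p \ A_p. -/
def Eset (τ : CCvTrace α V) (proc : α → P) : Set (Ev P α) :=
  {e | match e with
       | Ev.isu p a => a ∈ τ.Aset proc p
       | Ev.del p a => a ∈ τ.Aset' proc p ∧ a ∉ τ.Aset proc p}

/-- B₁ relates two events of a common process p whose underlying transactions
are ordered by <_p. -/
def B1 (τ : CCvTrace α V) (proc : α → P) (e₁ e₂ : Ev P α) : Prop :=
  e₁ ∈ τ.Eset proc ∧ e₂ ∈ τ.Eset proc ∧ e₁.procOf = e₂.procOf ∧
  τ.ltp proc e₁.procOf e₁.transOf e₂.transOf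

/-- B₂ relates the issue of each writing transaction to each of its deliveries. -/
def B2 (τ : CCvTrace α V) (proc : α → P) (e₁ e₂ : Ev P α) : Prop :=
  ∃ (a : α) (p : P), a ∈ τ.Wall ∧ a ∈ τ.Aset' proc p ∧ a ∉ τ.Aset proc p ∧
    e₁ = Ev.isu (proc a) a ∧ e₂ = Ev.del p a

/-- B₃ relates issue events along the coherence order. -/
def B3 (τ : CCvTrace α V) (proc : α → P) (e₁ e₂ : Ev P α) : Prop :=
  ∃ a b, τ.coU a b ∧ e₁ = Ev.isu (proc a) a ∧ e₂ = Ev.isu (proc b) b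

end CCvTrace

namespace CCvTrace

variable {α V P : Type*}

/-- The union of the three event relations. -/
def evStep (τ : CCvTrace α V) (proc : α → P) (u v : Ev P α) : Prop :=
  τ.B1 proc u v ∨ τ.B2 proc u v ∨ τ.B3 proc u v

/-- What holds of an event reachable from the issue of `a`: an issued transaction lies strictly
after `a` in `(po ∪ rf ∪ co)⁺`; a delivered one lies weakly after `a`, or does not happen before
some transaction of the delivering process that lies weakly after `a`. -/
def AfterIssue (τ : CCvTrace α V) (proc : α → P) (a : α) : Ev P α → Prop
  | .isu p b => b ∈ τ.Aset proc p ∧ TransGen τ.porfco a b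
  | .del p b => ReflTransGen τ.porfco a b ∨
      ∃ c ∈ τ.Aset proc p, ReflTransGen τ.porfco a c ∧ ¬ τ.hb b c

theorem hb.transGen_porfco {τ : CCvTrace α V} {a b : α} (h : τ.hb a b) :
    TransGen τ.porfco a b :=
  TransGen.mono (fun _ _ => Or.inl) _ _ h

theorem coU_mem {τ : CCvTrace α V} {a b : α} (h : τ.coU a b) : a ∈ τ.T ∧ b ∈ τ.T :=
  let ⟨x, hx⟩ := h
  ⟨τ.W_sub x (τ.co_mem x a b hx).1, τ.W_sub x (τ.co_mem x a b hx).2⟩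

/-- Out of an issue event, every step reaches an event that is after that issue. -/
theorem evStep.afterIssue {τ : CCvTrace α V} {proc : α → P} {p : P} {a c : α} {v : Ev P α}
    (hac : ReflTransGen τ.porfco a c) (h : τ.evStep proc (.isu p c) v) :
    τ.AfterIssue proc a v := by
  rcases h with ⟨hu, hv, hp, hlt⟩ | ⟨b, q, -, -, -, hu, rfl⟩ | ⟨b, d, hbd, hu, rfl⟩
  · rcases v with ⟨q, b⟩ | ⟨q, b⟩ <;> obtain rfl : p = q := hp
    · rcases hlt with ⟨-, -, hcb⟩ | ⟨-, -, hb, -⟩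
      · exact ⟨hv, hcb.transGen_porfco.trans_right hac⟩
      · exact absurd hv hb
    · rcases hlt with ⟨-, -, hcb⟩ | ⟨-, -, -, hbc⟩
      · exact Or.inl (hac.trans hcb.transGen_porfco.to_reflTransGen)
      · exact Or.inr ⟨c, hu, hac, hbc⟩
  · cases hu
    exact Or.inl hac
  · cases hu
    exact ⟨⟨(coU_mem hbd).2, rfl⟩, TransGen.tail' hac (Or.inr hbd)⟩

/-- Every step out of a delivery event follows the happens-before order within the process. -/
theorem evStep.of_del {τ : CCvTrace α V} {proc : α → P} {p : P} {b : α} {v : Ev P α}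
    (h : τ.evStep proc (.del p b) v) :
    v ∈ τ.Eset proc ∧ p = v.procOf ∧ τ.hb b v.transOf := by
  rcases h with ⟨hu, hv, hp, hlt⟩ | ⟨b, q, -, -, -, hu, -⟩ | ⟨b, d, -, hu, -⟩
  · rcases hlt with ⟨-, -, h⟩ | ⟨hb, -⟩
    · exact ⟨hv, hp, h⟩
    · exact absurd hb hu.2
  · cases hu
  · cases hu

theorem AfterIssue.evStep {τ : CCvTrace α V} {proc : α → P}
    (htot : ∀ a b, a ∈ τ.T → b ∈ τ.T → a ≠ b → proc a = proc b → τ.hb a b ∨ τ.hb b a)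
    {a : α} {u v : Ev P α} (hu : τ.AfterIssue proc a u) (h : τ.evStep proc u v) :
    τ.AfterIssue proc a v := by
  rcases u with ⟨p, b⟩ | ⟨p, b⟩
  · exact h.afterIssue hu.2.to_reflTransGen
  · obtain ⟨hv, hp, hbv⟩ := h.of_del
    rcases v with ⟨q, d⟩ | ⟨q, d⟩ <;> obtain rfl : p = q := hp <;> change τ.hb b d at hbv
    · refine ⟨hv, ?_⟩
      rcases hu with hab | ⟨c, hc, hac, hbc⟩
      · exact hbv.transGen_porfco.trans_right hab
      · have hcd : c ≠ d := by rintro rfl; exact hbc hbv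
        rcases htot c d hc.1 hv.1 hcd (hc.2.trans hv.2.symm) with h | h
        · exact h.transGen_porfco.trans_right hac
        · exact absurd (TransGen.trans hbv h) hbc
    · rcases hu with hab | ⟨c, hc, hac, hbc⟩
      · exact Or.inl (hab.trans hbv.transGen_porfco.to_reflTransGen)
      · exact Or.inr ⟨c, hc, hac, fun h => hbc (TransGen.trans hbv h)⟩

theorem afterIssue_of_transGen {τ : CCvTrace α V} {proc : α → P}
    (htot : ∀ a b, a ∈ τ.T → b ∈ τ.T → a ≠ b → proc a = proc b → τ.hb a b ∨ τ.hb b a)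
    {p : P} {a : α} {v : Ev P α} (h : TransGen (τ.evStep proc) (.isu p a) v) :
    τ.AfterIssue proc a v := by
  induction h with
  | single h => exact h.afterIssue .refl
  | tail _ h ih => exact ih.evStep htot h

/-- A path out of a delivery event either follows the happens-before order or passes through an
issue event. -/
theorem hb_or_exists_isu_of_transGen {τ : CCvTrace α V} {proc : α → P} {p : P} {b : α}
    {v : Ev P α} (h : TransGen (τ.evStep proc) (.del p b) v) :
    τ.hb b v.transOf ∨ ∃ q c, TransGen (τ.evStep proc) (.del p b) (.isu q c) ∧
      ReflTransGen (τ.evStep proc) (.isu q c) v := by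
  induction h with
  | single h => exact Or.inl h.of_del.2.2
  | @tail u w hu h ih =>
    rcases u with ⟨q, c⟩ | ⟨q, c⟩
    · exact Or.inr ⟨q, c, hu, .single h⟩
    · rcases ih with hbc | ⟨r, d, h₁, h₂⟩
      · exact Or.inl (TransGen.trans hbc h.of_del.2.2)
      · exact Or.inr ⟨r, d, h₁, h₂.tail h⟩

end CCvTrace

open Relation CCvTrace in
/-- if moreover (po ∪ rf ∪ co)⁺ is irreflexive, then the relation
(B₁ ∪ B₂ ∪ B₃)⁺ on events is irreflexive. -/
theorem transGen_B1B2B3_irrefl {α V P : Type*} (τ : CCvTrace α V) (proc : α → P)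
    (hirr : ∀ a, ¬ τ.hb a a)
    (htot : ∀ a b, a ∈ τ.T → b ∈ τ.T → a ≠ b → proc a = proc b → τ.hb a b ∨ τ.hb b a)
    (hacyc : ∀ a, ¬ TransGen τ.porfco a a) :
    ∀ e : Ev P α, ¬ TransGen (fun u v => τ.B1 proc u v ∨ τ.B2 proc u v ∨ τ.B3 proc u v) e e := by
  have hisu : ∀ p a, ¬ TransGen (τ.evStep proc) (.isu p a) (.isu p a) :=
    fun p a h => hacyc a (afterIssue_of_transGen htot h).2
  rintro (⟨p, a⟩ | ⟨p, b⟩) h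
  · exact hisu p a h
  · rcases hb_or_exists_isu_of_transGen h with hbb | ⟨q, c, h₁, h₂⟩
    · exact hirr b hbb
    · exact hisu q c (TransGen.trans_right h₂ h₁)
end
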